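/- arXiv:1707.01417 — 4 statements merged into one kernel-verified Lean document; each statement's English description precedes it below -/
import Mathlib

section
/- For every election E with m candidates, every committee size k ≤ m, every election E' obtained from E by a single adjacent swap, and every k-Borda winning committee W of E, there exists a k-Borda winning committee W' of E' with |W ∩ W'| ≥ k − 1; that is, the robustness level of the k-Borda rule is at most 1. -/
/-- An election with `m` candidates and `n` voters: each voter has a strict linear order on
the candidates, represented by the permutation sending each candidate to its position
(`0`-indexed, so the top-ranked candidate has position `0`). -/
structure Election (m n : ℕ) where
  pref : Fin n → (Fin m ≃ Fin m)

/-- `E'` is obtained from `E` by a single swap of two adjacent candidates in one voter's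
preference order. -/
def AdjacentSwap {m n : ℕ} (E E' : Election m n) : Prop :=
  ∃ (v0 : Fin n) (p q : Fin m), (p : ℕ) + 1 = (q : ℕ) ∧
    E'.pref v0 = (E.pref v0).trans (Equiv.swap p q) ∧
    ∀ v : Fin n, v ≠ v0 → E'.pref v = E.pref v

/-- The Borda score of candidate `c`: `∑_v (m − pos_v(c))` with `1`-indexed positions,
i.e. `∑_v (m − 1 − (0-indexed position of c))`. -/
def bordaScore {m n : ℕ} (E : Election m n) (c : Fin m) : ℕ :=
  ∑ v : Fin n, (m - 1 - (E.pref v c).val)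

/-- A size-`k` committee `W` is winning under a score assignment `s` if every member of `W`
has score at least the score of every candidate outside `W`. -/
def ScoreWinning {C α : Type*} [LinearOrder α] (s : C → α) (k : ℕ) (W : Finset C) : Prop :=
  W.card = k ∧ ∀ a ∈ W, ∀ b ∉ W, s b ≤ s a

/-- If only `y` may gain score and only `x` may lose score, then every winning committee can be
turned into a winning committee for the new scores by exchanging at most one member. -/
theorem ScoreWinning.exists_exchange {C α : Type*} [Fintype C] [DecidableEq C] [LinearOrder α]
    {s s' : C → α} {x y : C} (hle : ∀ c, c ≠ y → s' c ≤ s c) (hge : ∀ c, c ≠ x → s c ≤ s' c)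
    {k : ℕ} {W : Finset C} (hW : ScoreWinning s k W) :
    ∃ W' : Finset C, ScoreWinning s' k W' ∧ k - 1 ≤ (W ∩ W').card := by
  obtain ⟨hcard, hwin⟩ := hW
  by_cases h : ∀ a ∈ W, ∀ b ∉ W, s' b ≤ s' a
  · exact ⟨W, ⟨hcard, h⟩, by simp [hcard]⟩
  push Not at h
  obtain ⟨a₀, ha₀, b₀, hb₀, hlt⟩ := h
  obtain ⟨a, ha, hamin⟩ := W.exists_min_image s' ⟨a₀, ha₀⟩
  obtain ⟨b, hb, hbmax⟩ := Wᶜ.exists_max_image s' ⟨b₀, by simpa using hb₀⟩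
  simp only [Finset.mem_compl] at hb hbmax
  have hab : s' a < s' b := (hamin a₀ ha₀).trans_lt (hlt.trans_le (hbmax b₀ hb₀))
  have inverted : ∀ w ∈ W, ∀ c ∉ W, s' w < s' c → w = x ∨ c = y := by
    intro w hw c hc hwc
    by_contra! hne
    exact hwc.not_ge ((hle c hne.2).trans ((hwin w hw c hc).trans (hge w hne.1)))
  have hbW : b ∉ W.erase a := fun hmem => hb (Finset.mem_of_mem_erase hmem)
  refine ⟨insert b (W.erase a), ⟨?_, ?_⟩, ?_⟩
  · rw [Finset.card_insert_of_notMem hbW, Finset.card_erase_add_one ha, hcard]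
  · intro w hw c hc
    by_contra! hwc
    grind
  · have hsub : W.erase a ⊆ W ∩ insert b (W.erase a) :=
      Finset.subset_inter (Finset.erase_subset a W) (Finset.subset_insert _ _)
    simpa [Finset.card_erase_of_mem ha, hcard] using Finset.card_le_card hsub

/-- If every voter ranks `c` no lower in `E'` than in `E`, its Borda score does not decrease. -/
theorem bordaScore_le_of_pref_le {m n : ℕ} {E E' : Election m n} {c : Fin m}
    (h : ∀ v, E'.pref v c ≤ E.pref v c) : bordaScore E c ≤ bordaScore E' c :=
  Finset.sum_le_sum fun v _ => Nat.sub_le_sub_left (h v) _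

theorem statement2 {m n k : ℕ} (hk : k ≤ m) (E E' : Election m n)
    (hswap : AdjacentSwap E E') (W : Finset (Fin m))
    (hW : ScoreWinning (bordaScore E) k W) :
    ∃ W' : Finset (Fin m), ScoreWinning (bordaScore E') k W' ∧ k - 1 ≤ (W ∩ W').card := by
  obtain ⟨v₀, p, q, hpq, hv₀, hother⟩ := hswap
  have hlt : p ≤ q := Fin.le_def.2 (by omega)
  refine hW.exists_exchange (x := (E.pref v₀).symm p) (y := (E.pref v₀).symm q) ?_ ?_ <;>
    intro c hc <;> refine bordaScore_le_of_pref_le fun v => ?_ <;>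
    rw [ne_eq, Equiv.eq_symm_apply] at hc <;>
    obtain rfl | hv := eq_or_ne v v₀
  · rw [hv₀, Equiv.trans_apply, Equiv.swap_apply_def]
    grind
  · rw [hother v hv]
  · rw [hv₀, Equiv.trans_apply, Equiv.swap_apply_def]
    grind
  · rw [hother v hv]
end

section
/- For every election E with m candidates, every committee size k ≤ m, every election E' obtained from E by a single adjacent swap, and every SNTV winning committee W of E, there exists an SNTV winning committee W' of E' with |W ∩ W'| ≥ k − 1; that is, the robustness level of the SNTV rule is at most 1. -/
/-- The Plurality score of candidate `c`: the number of voters ranking `c` first. -/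
def pluralityScore {m n : ℕ} (E : Election m n) (c : Fin m) : ℕ :=
  (Finset.univ.filter (fun v : Fin n => (E.pref v c).val = 0)).card

/-- If one candidate loses a point and another gains one, a winning committee can be repaired by
exchanging at most one member. -/
theorem ScoreWinning.exists_of_transfer {C : Type*} [Fintype C] [DecidableEq C] {s s' : C → ℕ}
    {k : ℕ} {W : Finset C} (hW : ScoreWinning s k W) {a b : C} (ha : s a = s' a + 1)
    (hb : s' b = s b + 1) (hne : ∀ c, c ≠ a → c ≠ b → s' c = s c) :
    ∃ W' : Finset C, ScoreWinning s' k W' ∧ k - 1 ≤ (W ∩ W').card := by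
  obtain ⟨hcard, hwin⟩ := hW
  by_cases hgood : ∀ x ∈ W, ∀ y ∉ W, s' y ≤ s' x
  · exact ⟨W, ⟨hcard, hgood⟩, by simp [hcard]⟩
  push Not at hgood
  obtain ⟨x₀, hx₀, y₀, hy₀, hlt⟩ := hgood
  obtain ⟨x, hx, hmin⟩ := W.exists_min_image s' ⟨x₀, hx₀⟩
  obtain ⟨y, hy, hmax⟩ := Wᶜ.exists_max_image s' ⟨y₀, by simpa using hy₀⟩
  simp only [Finset.mem_compl] at hy hmax
  have hxy : s' x < s' y := (hmin _ hx₀).trans_lt (hlt.trans_le (hmax _ hy₀))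
  have hle : ∀ z, z ≠ b → s' z ≤ s z := fun z hz => by by_cases z = a <;> grind
  have hge : ∀ z, z ≠ a → s z ≤ s' z := fun z hz => by by_cases z = b <;> grind
  have key : ∀ w ∈ W, w ≠ x → ∀ c ∉ W, c ≠ y → s' c ≤ s' w := by
    intro w hw hwx c hc hcy
    have := hwin w hw c hc
    have := hwin w hw y hy
    have := hwin x hx c hc
    have := hwin x hx y hy
    have := hmin w hw
    have := hmax c hc
    by_cases y = b <;> by_cases c = b <;> by_cases w = a <;> by_cases x = a <;> grind
  have hinter : W.erase x ⊆ W ∩ insert y (W.erase x) := by grind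
  refine ⟨insert y (W.erase x), ⟨?_, ?_⟩, ?_⟩
  · rw [Finset.card_insert_of_notMem (by simp [hy]), Finset.card_erase_add_one hx, hcard]
  · intro w hw c hc
    rw [Finset.mem_insert, Finset.mem_erase] at hw hc
    grind
  · calc k - 1 = (W.erase x).card := by rw [Finset.card_erase_of_mem hx, hcard]
      _ ≤ _ := Finset.card_le_card hinter

/-- The Plurality score splits into the contribution of one voter and that of the others. -/
theorem pluralityScore_eq_add {m n : ℕ} (E : Election m n) (v₀ : Fin n) (c : Fin m) :
    pluralityScore E c = (if (E.pref v₀ c).val = 0 then 1 else 0) +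
      ∑ v ∈ Finset.univ.erase v₀, if (E.pref v c).val = 0 then 1 else 0 := by
  rw [pluralityScore, Finset.card_filter]
  exact (Finset.add_sum_erase _ (fun v => if (E.pref v c).val = 0 then 1 else 0)
    (Finset.mem_univ v₀)).symm

theorem statement3 {m n k : ℕ} (hk : k ≤ m) (E E' : Election m n)
    (hswap : AdjacentSwap E E') (W : Finset (Fin m))
    (hW : ScoreWinning (pluralityScore E) k W) :
    ∃ W' : Finset (Fin m), ScoreWinning (pluralityScore E') k W' ∧ k - 1 ≤ (W ∩ W').card := by
  obtain ⟨v₀, p, q, hpq, hv₀, hother⟩ := hswap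
  have hrest (c : Fin m) : (∑ v ∈ Finset.univ.erase v₀, if (E'.pref v c).val = 0 then 1 else 0) =
      ∑ v ∈ Finset.univ.erase v₀, if (E.pref v c).val = 0 then 1 else 0 :=
    Finset.sum_congr rfl fun v hv => by rw [hother v (Finset.ne_of_mem_erase hv)]
  have hscore' (c : Fin m) := pluralityScore_eq_add E' v₀ c
  have hscore (c : Fin m) := pluralityScore_eq_add E v₀ c
  simp only [hrest, hv₀, Equiv.trans_apply] at hscore'
  by_cases hp : (p : ℕ) = 0
  · have hq : (q : ℕ) ≠ 0 := by omega
    refine hW.exists_of_transfer (a := (E.pref v₀).symm p) (b := (E.pref v₀).symm q) ?_ ?_ ?_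
    · rw [hscore, hscore']
      simp [hp, hq, add_comm]
    · rw [hscore, hscore']
      simp [hp, hq, add_comm]
    · intro c hca hcb
      rw [hscore, hscore', Equiv.swap_apply_of_ne_of_ne]
      · rwa [ne_eq, ← Equiv.eq_symm_apply]
      · rwa [ne_eq, ← Equiv.eq_symm_apply]
  · have hsame : pluralityScore E' = pluralityScore E := by
      funext c
      rw [hscore, hscore']
      have hiff : (Equiv.swap p q (E.pref v₀ c)).val = 0 ↔ (E.pref v₀ c).val = 0 := by
        rw [Equiv.swap_apply_def]
        split_ifs with h₁ h₂
        · rw [h₁]; omega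
        · rw [h₂]; omega
        · rfl
      simp only [hiff]
    exact ⟨W, hsame ▸ hW, by simp [hW.1]⟩
end

section
/- For every election E with m candidates, every committee size k ≤ m, every election E' obtained from E by a single adjacent swap, and every Bloc winning committee W of E, there exists a Bloc winning committee W' of E' with |W ∩ W'| ≥ k − 1; that is, the robustness level of the Bloc rule is at most 1. -/
/-- The `k`-Approval score of candidate `c`: the number of voters ranking `c` among their
top `k` positions. -/
def approvalScore {m n : ℕ} (k : ℕ) (E : Election m n) (c : Fin m) : ℕ :=
  (Finset.univ.filter (fun v : Fin n => (E.pref v c).val < k)).card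

/-- If the scores change so that every candidate but `x` does at least as well and every candidate
but `y` does at most as well as before, then some new winning committee differs from a given old
one in at most one member. -/
theorem ScoreWinning.exists_card_inter_ge {C α : Type*} [Fintype C] [DecidableEq C] [LinearOrder α]
    {s s' : C → α} {k : ℕ} {W : Finset C} (hW : ScoreWinning s k W) (x y : C)
    (hx : ∀ c, c ≠ x → s c ≤ s' c) (hy : ∀ c, c ≠ y → s' c ≤ s c) :
    ∃ W' : Finset C, ScoreWinning s' k W' ∧ k - 1 ≤ (W ∩ W').card := by
  obtain ⟨hcard, hwin⟩ := hW
  by_cases hkeep : ∀ a ∈ W, ∀ b ∉ W, s' b ≤ s' a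
  · exact ⟨W, ⟨hcard, hkeep⟩, by simp [hcard]⟩
  push Not at hkeep
  obtain ⟨a₀, ha₀, b₀, hb₀, hlt⟩ := hkeep
  obtain ⟨w, hw, hmin⟩ := W.exists_min_image s' ⟨a₀, ha₀⟩
  obtain ⟨z, hz, hmax⟩ := Wᶜ.exists_max_image s' ⟨b₀, by simpa using hb₀⟩
  simp only [Finset.mem_compl] at hz hmax
  have hwz : s' w < s' z := (hmin a₀ ha₀).trans_lt (hlt.trans_le (hmax b₀ hb₀))
  have hzw : z ∉ W.erase w := fun h => hz (Finset.mem_of_mem_erase h)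
  refine ⟨insert z (W.erase w), ⟨?_, ?_⟩, ?_⟩
  · rw [Finset.card_insert_of_notMem hzw, Finset.card_erase_add_one hw, hcard]
  · intro a ha b hb
    simp only [Finset.mem_insert, Finset.mem_erase, not_or, not_and'] at ha hb
    obtain ⟨hbz, hbw⟩ := hb
    rcases ha with rfl | ⟨haw, haW⟩
    · by_cases hbW : b ∈ W
      · rw [not_not.mp (hbw hbW)]
        exact hwz.le
      · exact hmax b hbW
    · by_cases hbW : b ∈ W
      · rw [not_not.mp (hbw hbW)]
        exact hmin a haW
      · obtain ⟨a', ha', hsa⟩ : ∃ a' ∈ W, s a' ≤ s' a := by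
          by_cases hax : a = x
          · exact ⟨w, hw, (hx w fun h => haw (hax.trans h.symm)).trans (hmin a haW)⟩
          · exact ⟨a, haW, hx a hax⟩
        obtain ⟨b', hb', hsb⟩ : ∃ b' ∉ W, s' b ≤ s b' := by
          by_cases hby : b = y
          · exact ⟨z, hz, (hmax b hbW).trans (hy z fun h => hbz (hby.trans h.symm))⟩
          · exact ⟨b, hbW, hy b hby⟩
        exact hsb.trans ((hwin a' ha' b' hb').trans hsa)
  · rw [← hcard, ← Finset.card_erase_of_mem hw]
    exact Finset.card_le_card (Finset.subset_inter (Finset.erase_subset _ _)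
      (Finset.subset_insert _ _))

theorem approvalScore_le_of_pref_le {m n : ℕ} (k : ℕ) {E E' : Election m n} {c : Fin m}
    (h : ∀ v, E'.pref v c ≤ E.pref v c) : approvalScore k E c ≤ approvalScore k E' c :=
  Finset.card_le_card (Finset.monotone_filter_right _ fun v _ hv => lt_of_le_of_lt (h v) hv)

theorem swap_apply_le_of_ne_left {α : Type*} [LinearOrder α] {p q r : α} (hpq : p ≤ q)
    (hr : r ≠ p) : Equiv.swap p q r ≤ r := by
  rw [Equiv.swap_apply_def]
  split_ifs <;> simp_all

theorem le_swap_apply_of_ne_right {α : Type*} [LinearOrder α] {p q r : α} (hpq : p ≤ q)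
    (hr : r ≠ q) : r ≤ Equiv.swap p q r := by
  rw [Equiv.swap_apply_def]
  split_ifs <;> simp_all

theorem statement4 {m n k : ℕ} (hk : k ≤ m) (E E' : Election m n)
    (hswap : AdjacentSwap E E') (W : Finset (Fin m))
    (hW : ScoreWinning (approvalScore k E) k W) :
    ∃ W' : Finset (Fin m), ScoreWinning (approvalScore k E') k W' ∧ k - 1 ≤ (W ∩ W').card := by
  obtain ⟨v₀, p, q, hpq, hv₀, hv⟩ := hswap
  have hle : p ≤ q := Fin.le_def.mpr (by omega)
  refine hW.exists_card_inter_ge ((E.pref v₀).symm p) ((E.pref v₀).symm q) ?_ ?_ <;>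
    refine fun c hc => approvalScore_le_of_pref_le k fun v => ?_ <;>
    rw [Ne, Equiv.eq_symm_apply] at hc <;>
    rcases eq_or_ne v v₀ with rfl | hne
  · rw [hv₀]
    exact swap_apply_le_of_ne_left hle hc
  · rw [hv v hne]
  · rw [hv₀]
    exact le_swap_apply_of_ne_right hle hc
  · rw [hv v hne]
end

section
/- For every α ∈ [0,1], every election E with m candidates, every committee size k ≤ m, every election E' obtained from E by a single adjacent swap, and every k-Copeland^α winning committee W of E, there exists a k-Copeland^α winning committee W' of E' with |W ∩ W'| ≥ k − 1; that is, the robustness level of the k-Copeland^α rule is at most 1. -/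
/-- The number of voters ranking `x` above `y` (smaller position = higher rank). -/
def prefCount {m n : ℕ} (E : Election m n) (x y : Fin m) : ℕ :=
  (Finset.univ.filter (fun v : Fin n => E.pref v x < E.pref v y)).card

/-- The Copeland^α score of candidate `c`: the number of candidates `d` such that a strict
majority of the voters rank `c` above `d`, plus `α` times the number of candidates `e ≠ c`
such that exactly half of the voters rank `c` above `e`. -/
noncomputable def copelandScore {m n : ℕ} (α : ℝ) (E : Election m n) (c : Fin m) : ℝ :=
  ((Finset.univ.filter (fun d : Fin m => n < 2 * prefCount E c d)).card : ℝ) +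
    α * ((Finset.univ.filter (fun e : Fin m => e ≠ c ∧ 2 * prefCount E c e = n)).card : ℝ)

/-- The Copeland score of `c` is monotone in the pairwise support of `c`. -/
lemma copelandScore_mono {α : ℝ} (hα0 : 0 ≤ α) (hα1 : α ≤ 1) {m n : ℕ} {E E' : Election m n}
    {c : Fin m} (h : ∀ d, prefCount E c d ≤ prefCount E' c d) :
    copelandScore α E c ≤ copelandScore α E' c := by
  simp only [copelandScore, Finset.card_filter, Nat.cast_sum, Finset.mul_sum,
    ← Finset.sum_add_distrib]
  refine Finset.sum_le_sum fun d _ => ?_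
  by_cases hd : d = c
  · have hself : ∀ F : Election m n, prefCount F c c = 0 := fun F => by simp [prefCount]
    simp [hd, hself]
  · have := h d
    split_ifs <;> first | omega | (push_cast; linarith)

lemma Fin.swap_lt_swap_of_ne {m : ℕ} {p q x y : Fin m} (hpq : (p : ℕ) + 1 = q) (hx : x ≠ p)
    (h : x < y) : Equiv.swap p q x < Equiv.swap p q y := by
  simp only [Equiv.swap_apply_def]
  split_ifs <;> grind

lemma Fin.lt_of_swap_lt_swap {m : ℕ} {p q x y : Fin m} (hpq : (p : ℕ) + 1 = q) (hx : x ≠ q)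
    (h : Equiv.swap p q x < Equiv.swap p q y) : x < y := by
  have hne : Equiv.swap p q x ≠ p := fun h' => hx (by
    rw [← Equiv.swap_apply_self p q x, h', Equiv.swap_apply_left])
  simpa using Fin.swap_lt_swap_of_ne hpq hne h

/-- An adjacent swap lowers the score of at most one candidate and raises the score of at most
one candidate. -/
lemma AdjacentSwap.exists_copelandScore_le {α : ℝ} (hα0 : 0 ≤ α) (hα1 : α ≤ 1) {m n : ℕ}
    {E E' : Election m n} (h : AdjacentSwap E E') :
    ∃ a b : Fin m, (∀ c, c ≠ a → copelandScore α E c ≤ copelandScore α E' c) ∧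
      ∀ c, c ≠ b → copelandScore α E' c ≤ copelandScore α E c := by
  obtain ⟨v₀, p, q, hpq, hv₀, hv⟩ := h
  refine ⟨(E.pref v₀).symm p, (E.pref v₀).symm q, fun c hc => ?_, fun c hc => ?_⟩ <;>
    rw [ne_eq, Equiv.eq_symm_apply] at hc <;>
    refine copelandScore_mono hα0 hα1 fun d =>
      Finset.card_le_card (Finset.monotone_filter_right _ fun v _ hlt => ?_) <;>
    by_cases hvv : v = v₀
  · subst hvv
    simpa only [hv₀, Equiv.trans_apply] using Fin.swap_lt_swap_of_ne hpq hc hlt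
  · simpa only [hv v hvv] using hlt
  · subst hvv
    simp only [hv₀, Equiv.trans_apply] at hlt
    exact Fin.lt_of_swap_lt_swap hpq hc hlt
  · simpa only [hv v hvv] using hlt

/-- If at most one score decreases and at most one score increases, then a winning committee can
be repaired by exchanging at most one member. -/
lemma ScoreWinning.exists_inter_card {C R : Type*} [Fintype C] [DecidableEq C] [LinearOrder R]
    {s s' : C → R} {k : ℕ} {W : Finset C} (hW : ScoreWinning s k W) {a b : C}
    (ha : ∀ c, c ≠ a → s c ≤ s' c) (hb : ∀ c, c ≠ b → s' c ≤ s c) :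
    ∃ W' : Finset C, ScoreWinning s' k W' ∧ k - 1 ≤ (W ∩ W').card := by
  obtain ⟨hcard, hwin⟩ := hW
  by_cases hstay : ∀ u ∈ W, ∀ z ∉ W, s' z ≤ s' u
  · exact ⟨W, ⟨hcard, hstay⟩, by simp [hcard]⟩
  push Not at hstay
  obtain ⟨u₀, hu₀, z₀, hz₀, hlt₀⟩ := hstay
  obtain ⟨x, hx, hxmin⟩ := W.exists_min_image s' ⟨u₀, hu₀⟩
  obtain ⟨y, hy, hymax⟩ := Wᶜ.exists_max_image s' ⟨z₀, by simpa using hz₀⟩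
  simp only [Finset.mem_compl] at hy hymax
  have hxy : s' x ≤ s' y := (hxmin u₀ hu₀).trans (hlt₀.le.trans (hymax z₀ hz₀))
  have hyx : y ∉ W.erase x := fun h => hy (Finset.mem_of_mem_erase h)
  refine ⟨insert y (W.erase x), ⟨?_, fun u hu z hz => ?_⟩, ?_⟩
  · rw [Finset.card_insert_of_notMem hyx, Finset.card_erase_add_one hx, hcard]
  · simp only [Finset.mem_insert, Finset.mem_erase, not_or, not_and_or, not_not] at hu hz
    obtain ⟨hzy, rfl | hzW⟩ := hz
    · rcases hu with rfl | hu
      · exact hxy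
      · exact hxmin u hu.2
    rcases hu with rfl | ⟨hux, huW⟩
    · exact hymax z hzW
    obtain ⟨z', hz'W, hz'b, hzz'⟩ : ∃ z', z' ∉ W ∧ z' ≠ b ∧ s' z ≤ s' z' := by
      by_cases hzb : z = b
      · exact ⟨y, hy, fun h => hzy (hzb.trans h.symm), hymax z hzW⟩
      · exact ⟨z, hzW, hzb, le_rfl⟩
    obtain ⟨u', hu'W, hu'a, huu'⟩ : ∃ u', u' ∈ W ∧ u' ≠ a ∧ s' u' ≤ s' u := by
      by_cases hua : u = a
      · exact ⟨x, hx, fun h => hux (hua.trans h.symm), hxmin u huW⟩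
      · exact ⟨u, huW, hua, le_rfl⟩
    exact hzz'.trans ((hb z' hz'b).trans ((hwin u' hu'W z' hz'W).trans ((ha u' hu'a).trans huu')))
  · rw [← hcard, ← Finset.card_erase_of_mem hx]
    exact Finset.card_le_card (Finset.subset_inter (Finset.erase_subset x W)
      (Finset.subset_insert y _))

theorem statement6 (α : ℝ) (hα0 : 0 ≤ α) (hα1 : α ≤ 1)
    {m n k : ℕ} (hk : k ≤ m) (E E' : Election m n)
    (hswap : AdjacentSwap E E') (W : Finset (Fin m))
    (hW : ScoreWinning (copelandScore α E) k W) :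
    ∃ W' : Finset (Fin m),
      ScoreWinning (copelandScore α E') k W' ∧ k - 1 ≤ (W ∩ W').card := by
  obtain ⟨a, b, ha, hb⟩ := hswap.exists_copelandScore_le hα0 hα1
  exact hW.exists_inter_card ha hb
end
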